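/- Anderson's comparison inequality: let X and Y be zero-mean Gaussian random vectors in ℝ^d with covariance matrices Σ_X and Σ_Y respectively. If Σ_X − Σ_Y is positive semi-definite, then for every convex symmetric set C ⊆ ℝ^d, P(X ∈ C) ≤ P(Y ∈ C). -/

import Mathlib

open MeasureTheory ProbabilityTheory Matrix

/-- The standard Gaussian measure on `ℝ^d` (i.i.d. `N(0,1)` coordinates). -/
noncomputable def stdGaussian (d : ℕ) : Measure (Fin d → ℝ) :=
  Measure.pi (fun _ : Fin d => gaussianReal 0 1)

lemma bm1c {K L M : Set ℝ} (hK : IsCompact K) (hL : IsCompact L) (nK : K.Nonempty) (nL : L.Nonempty)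
    (h : ∀ x ∈ K, ∀ y ∈ L, x + y ∈ M) : volume K + volume L ≤ volume M := by
  obtain ⟨k, hk, hk'⟩ := hK.exists_isGreatest nK
  obtain ⟨l, hl, hl'⟩ := hL.exists_isLeast nL
  have h1 : volume ((fun x => x + (-l)) ⁻¹' K) = volume K := measure_preimage_add_right _ _ _
  have h2 : volume ((fun x => (-k) + x) ⁻¹' L) = volume L := measure_preimage_add _ _ _
  rw [← h1, ← h2, ← measure_union₀]
  · apply measure_mono
    rintro z (hz | hz)
    · have := h _ hz _ hl
      simpa using this
    · have := h _ hk _ hz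
      simpa using this
  · exact (hL.measurableSet.preimage (by fun_prop)).nullMeasurableSet
  · refine measure_mono_null (t := {k + l}) ?_ (by simp)
    rintro z ⟨hz1, hz2⟩
    have a1 := hk' hz1
    have a2 := hl' hz2
    simp only at a1 a2
    simp only [Set.mem_singleton_iff]
    linarith

lemma bm1 {A B M : Set ℝ} (hA : MeasurableSet A) (hB : MeasurableSet B) (nA : A.Nonempty)
    (nB : B.Nonempty)
    (h : ∀ x ∈ A, ∀ y ∈ B, x + y ∈ M) : volume A + volume B ≤ volume M := by
  obtain ⟨a, ha⟩ := nA
  obtain ⟨b, hb⟩ := nB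
  rw [hA.measure_eq_iSup_isCompact, hB.measure_eq_iSup_isCompact]
  simp only [iSup_and']
  refine ENNReal.biSup_add_biSup_le' ⟨∅, by simp⟩ ⟨∅, by simp⟩ ?_
  rintro K ⟨hKA, hK⟩ L ⟨hLB, hL⟩
  refine le_trans ?_ (bm1c (M := M) (hK.insert a) (hL.insert b) (by simp) (by simp) ?_)
  · gcongr <;> simp
  · intro x hx y hy
    exact h x (Set.insert_subset ha hKA hx) y (Set.insert_subset hb hLB hy)

lemma bm1half {A B M : Set ℝ} (hA : MeasurableSet A) (hB : MeasurableSet B) (nA : A.Nonempty)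
    (nB : B.Nonempty)
    (h : ∀ x ∈ A, ∀ y ∈ B, (x + y) / 2 ∈ M) : volume A + volume B ≤ 2 * volume M := by
  have := bm1 (M := (fun x => 2⁻¹ * x) ⁻¹' M) hA hB nA nB (fun x hx y hy => by
    have := h x hx y hy
    rw [div_eq_inv_mul] at this
    exact this)
  rw [Real.volume_preimage_mul_left (by norm_num)] at this
  simpa using this

lemma pl_norm {f g h : ℝ → ℝ} (hf : Measurable f) (hg : Measurable g) (hh : Measurable h)
    (f0 : ∀ x, 0 ≤ f x) (g0 : ∀ x, 0 ≤ g x) (h0 : ∀ x, 0 ≤ h x)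
    (f1 : ∀ x, f x ≤ 1) (g1 : ∀ x, g x ≤ 1)
    (fs : ∀ t < 1, ∃ x, t < f x) (gs : ∀ t < 1, ∃ x, t < g x)
    (H : ∀ x y, f x * g y ≤ h ((x + y) / 2) ^ 2) :
    (∫⁻ x, ENNReal.ofReal (f x)) + (∫⁻ x, ENNReal.ofReal (g x)) ≤
      2 * ∫⁻ x, ENNReal.ofReal (h x) := by
  rw [lintegral_eq_lintegral_meas_lt volume (.of_forall f0) hf.aemeasurable,
    lintegral_eq_lintegral_meas_lt volume (.of_forall g0) hg.aemeasurable,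
    lintegral_eq_lintegral_meas_lt volume (.of_forall h0) hh.aemeasurable,
    ← lintegral_add_left', ← lintegral_const_mul']
  · refine setLIntegral_mono' measurableSet_Ioi fun t ht => ?_
    have ht : 0 < t := ht
    rcases lt_or_ge t 1 with h1 | h1
    · refine bm1half (measurableSet_lt measurable_const hf) (measurableSet_lt measurable_const hg)
        (fs t h1) (gs t h1) fun x hx y hy => ?_
      have hx : t < f x := hx
      have hy : t < g y := hy
      have := H x y
      change t < h _
      apply lt_of_pow_lt_pow_left₀ 2 (h0 _)
      nlinarith
    · have e1 : {a | t < f a} = ∅ := by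
        ext x; simpa using (f1 x).trans h1
      have e2 : {a | t < g a} = ∅ := by
        ext x; simpa using (g1 x).trans h1
      simp [e1, e2]
  · simp
  · apply Measurable.aemeasurable
    refine Antitone.measurable fun s t hst => measure_mono fun x hx => ?_
    exact lt_of_le_of_lt hst hx

lemma amgm {a b c : ENNReal} (h : a + b ≤ 2 * c) : a * b ≤ c ^ 2 := by
  by_cases hc : c = ⊤
  · simp [hc]
  have hs : a + b ≠ ⊤ := ne_top_of_le_ne_top (by finiteness) h
  have ha : a ≠ ⊤ := fun h => hs (by simp [h])
  have hb : b ≠ ⊤ := fun h => hs (by simp [h])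
  lift a to NNReal using ha
  lift b to NNReal using hb
  lift c to NNReal using hc
  norm_cast at *
  have h' : (a : ℝ) + b ≤ 2 * c := by exact_mod_cast h
  have : (a : ℝ) * b ≤ c ^ 2 := by
    have := a.2; have := b.2
    nlinarith [sq_nonneg ((a : ℝ) - b), a.2, b.2, c.2]
  exact_mod_cast this

lemma pl {f g h : ℝ → ℝ} (hf : Measurable f) (hg : Measurable g) (hh : Measurable h)
    (f0 : ∀ x, 0 ≤ f x) (g0 : ∀ x, 0 ≤ g x) (h0 : ∀ x, 0 ≤ h x)
    (f1 : BddAbove (Set.range f)) (g1 : BddAbove (Set.range g))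
    (H : ∀ x y, f x * g y ≤ h ((x + y) / 2) ^ 2) :
    (∫⁻ x, ENNReal.ofReal (f x)) * (∫⁻ x, ENNReal.ofReal (g x)) ≤
      (∫⁻ x, ENNReal.ofReal (h x)) ^ 2 := by
  set a := ⨆ x, f x with ha
  set b := ⨆ x, g x with hb
  have fa : ∀ x, f x ≤ a := fun x => le_ciSup f1 x
  have gb : ∀ x, g x ≤ b := fun x => le_ciSup g1 x
  have a0 : 0 ≤ a := (f0 0).trans (fa 0)
  have b0 : 0 ≤ b := (g0 0).trans (gb 0)
  rcases a0.eq_or_lt with a0 | a0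
  · have : ∀ x, f x = 0 := fun x => le_antisymm (by rw [a0]; exact fa x) (f0 x)
    simp [this]
  rcases b0.eq_or_lt with b0 | b0
  · have : ∀ x, g x = 0 := fun x => le_antisymm (by rw [b0]; exact gb x) (g0 x)
    simp [this]
  set c := √(a * b) with hc
  have c0 : 0 < c := by positivity
  have c2 : c ^ 2 = a * b := Real.sq_sqrt (by positivity)
  have key := amgm (pl_norm (f := fun x => a⁻¹ * f x) (g := fun x => b⁻¹ * g x)
    (h := fun x => c⁻¹ * h x) (by fun_prop) (by fun_prop) (by fun_prop)
    (fun x => mul_nonneg (by positivity) (f0 x)) (fun x => mul_nonneg (by positivity) (g0 x))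
    (fun x => mul_nonneg (by positivity) (h0 x))
    (fun x => by rw [inv_mul_le_iff₀ a0]; simpa using fa x)
    (fun x => by rw [inv_mul_le_iff₀ b0]; simpa using gb x)
    (fun t ht => by
      obtain ⟨x, hx⟩ := exists_lt_of_lt_ciSup (show a * t < ⨆ x, f x by rw [← ha]; nlinarith)
      exact ⟨x, by rw [lt_inv_mul_iff₀ a0]; exact hx⟩)
    (fun t ht => by
      obtain ⟨x, hx⟩ := exists_lt_of_lt_ciSup (show b * t < ⨆ x, g x by rw [← hb]; nlinarith)
      exact ⟨x, by rw [lt_inv_mul_iff₀ b0]; exact hx⟩)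
    (fun x y => by
      rw [mul_pow, inv_pow, c2, mul_inv]
      have := mul_le_mul_of_nonneg_left (H x y) (show 0 ≤ a⁻¹ * b⁻¹ by positivity)
      linarith))
  simp only [ENNReal.ofReal_mul (inv_nonneg.2 a0.le), ENNReal.ofReal_mul (inv_nonneg.2 b0.le),
    ENNReal.ofReal_mul (inv_nonneg.2 c0.le)] at key
  rw [lintegral_const_mul' _ _ (by finiteness), lintegral_const_mul' _ _ (by finiteness),
    lintegral_const_mul' _ _ (by finiteness), mul_pow, mul_mul_mul_comm,
    ← ENNReal.ofReal_mul (inv_nonneg.2 a0.le), ← ENNReal.ofReal_pow (inv_nonneg.2 c0.le), inv_pow,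
    c2, mul_inv] at key
  rwa [ENNReal.mul_le_mul_iff_right] at key
  · simp; positivity
  · finiteness

instance (d : ℕ) : IsProbabilityMeasure (_root_.stdGaussian d) := by
  unfold _root_.stdGaussian; infer_instance

lemma std_succ (d : ℕ) {K : Set (Fin (d + 1) → ℝ)} (hK : MeasurableSet K) :
    Measurable (fun s => _root_.stdGaussian d {y | (Fin.cons s y : Fin (d + 1) → ℝ) ∈ K}) ∧
    _root_.stdGaussian (d + 1) K = ∫⁻ s, ENNReal.ofReal
      ((_root_.stdGaussian d).real {y | (Fin.cons s y : Fin (d + 1) → ℝ) ∈ K} *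
        gaussianPDFReal 0 1 s) := by
  have mp := measurePreserving_piFinSuccAbove (fun _ : Fin (d + 1) => gaussianReal 0 1) 0
  set e := MeasurableEquiv.piFinSuccAbove (fun _ : Fin (d + 1) => ℝ) 0 with he
  have mp' := mp.symm
  have hK' : MeasurableSet (e.symm ⁻¹' K) := e.symm.measurable hK
  have hpre : ∀ s, Prod.mk s ⁻¹' (e.symm ⁻¹' K) =
      {y | (Fin.cons s y : Fin (d + 1) → ℝ) ∈ K} := by
    intro s
    ext y
    simp [he, MeasurableEquiv.piFinSuccAbove]
    rfl
  have hm := measurable_measure_prodMk_left (ν := _root_.stdGaussian d) hK'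
  simp only [hpre] at hm
  refine ⟨hm, ?_⟩
  have h1 : _root_.stdGaussian (d + 1) K =
      ((gaussianReal 0 1).prod (_root_.stdGaussian d)) (e.symm ⁻¹' K) :=
    (mp'.measure_preimage_equiv K).symm
  rw [h1, Measure.prod_apply hK', gaussianReal_of_var_ne_zero 0 one_ne_zero,
    lintegral_withDensity_eq_lintegral_mul _ (measurable_gaussianPDF 0 1)]
  · refine lintegral_congr fun s => ?_
    rw [Pi.mul_apply, hpre, ENNReal.ofReal_mul measureReal_nonneg, ofReal_measureReal, mul_comm]
    rfl
  · simpa only [hpre] using hm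

lemma pdf_bdd (s : ℝ) : gaussianPDFReal 0 1 s ≤ gaussianPDFReal 0 1 0 := by
  unfold gaussianPDFReal
  refine mul_le_mul_of_nonneg_left (Real.exp_le_exp.2 ?_) (by positivity)
  simp only [NNReal.coe_one]
  nlinarith [sq_nonneg s]

lemma pdf_mid (x y : ℝ) : gaussianPDFReal 0 1 x * gaussianPDFReal 0 1 y ≤
    gaussianPDFReal 0 1 ((x + y) / 2) ^ 2 := by
  unfold gaussianPDFReal
  rw [mul_mul_mul_comm, mul_pow, ← Real.exp_add, sq (√_)⁻¹, ← Real.exp_nat_mul]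
  gcongr
  simp only [NNReal.coe_one, Nat.cast_ofNat]
  nlinarith [sq_nonneg (x - y)]

lemma std_logconcave (d : ℕ) : ∀ {K L M : Set (Fin d → ℝ)}, MeasurableSet K → MeasurableSet L →
    MeasurableSet M → (∀ x ∈ K, ∀ y ∈ L, (fun i => (x i + y i) / 2) ∈ M) →
    _root_.stdGaussian d K * _root_.stdGaussian d L ≤ _root_.stdGaussian d M ^ 2 := by
  induction d with
  | zero =>
    intro K L M hK hL hM h
    rcases K.eq_empty_or_nonempty with rfl | ⟨x, hx⟩
    · simp
    rcases L.eq_empty_or_nonempty with rfl | ⟨y, hy⟩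
    · simp
    have : M = Set.univ := by
      ext z
      simp only [Set.mem_univ, iff_true]
      rw [Subsingleton.elim z]
      exact h x hx y hy
    subst this
    simpa using mul_le_one' (prob_le_one (μ := _root_.stdGaussian 0) (s := K)) prob_le_one
  | succ d ih =>
    intro K L M hK hL hM h
    obtain ⟨mK, eK⟩ := std_succ d hK
    obtain ⟨mL, eL⟩ := std_succ d hL
    obtain ⟨mM, eM⟩ := std_succ d hM
    have bdd : ∀ T : ℝ → Set (Fin d → ℝ), BddAbove (Set.range fun s =>
        (_root_.stdGaussian d).real (T s) * gaussianPDFReal 0 1 s) := by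
      intro T
      refine ⟨1 * gaussianPDFReal 0 1 0, ?_⟩
      rintro _ ⟨s, rfl⟩
      exact mul_le_mul measureReal_le_one (pdf_bdd s) (gaussianPDFReal_nonneg _ _ _) zero_le_one
    have nn : ∀ T : ℝ → Set (Fin d → ℝ), ∀ s,
        0 ≤ (_root_.stdGaussian d).real (T s) * gaussianPDFReal 0 1 s := fun T s =>
      mul_nonneg measureReal_nonneg (gaussianPDFReal_nonneg _ _ _)
    have sm : ∀ {T : Set (Fin (d + 1) → ℝ)}, MeasurableSet T → ∀ s : ℝ,
        MeasurableSet {y | (Fin.cons s y : Fin (d + 1) → ℝ) ∈ T} := by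
      intro T hT s
      refine hT.preimage (measurable_pi_iff.2 fun i => ?_)
      refine Fin.cases ?_ (fun j => ?_) i
      · simp
      · simpa using measurable_pi_apply j
    rw [eK, eL, eM]
    refine pl (mK.ennreal_toReal.mul (measurable_gaussianPDFReal 0 1))
      (mL.ennreal_toReal.mul (measurable_gaussianPDFReal 0 1))
      (mM.ennreal_toReal.mul (measurable_gaussianPDFReal 0 1))
      (nn _) (nn _) (nn _) (bdd _) (bdd _) fun s t => ?_
    rw [mul_mul_mul_comm, mul_pow]
    refine mul_le_mul ?_ (pdf_mid s t) (mul_nonneg (gaussianPDFReal_nonneg _ _ _)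
      (gaussianPDFReal_nonneg _ _ _)) (by positivity)
    have := ih (sm hK s) (sm hL t) (sm hM ((s + t) / 2)) (fun x hx y hy => by
      have := h _ hx _ hy
      have e : (Fin.cons ((s + t) / 2) (fun i => (x i + y i) / 2) : Fin (d + 1) → ℝ) =
          fun i => ((Fin.cons s x : Fin (d + 1) → ℝ) i + (Fin.cons t y : Fin (d + 1) → ℝ) i) / 2 := by
        ext i
        refine Fin.cases ?_ (fun j => ?_) i <;> simp
      rw [← e] at this
      exact this)
    have := ENNReal.toReal_mono (by finiteness) this
    simpa [Measure.real] using this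

lemma std_neg (d : ℕ) : (_root_.stdGaussian d).map (fun x => -x) = _root_.stdGaussian d := by
  have : ∀ i : Fin d, (gaussianReal 0 1).map (fun x => -x) = gaussianReal 0 1 := by
    intro i; simp [gaussianReal_map_neg]
  unfold _root_.stdGaussian
  have h2 := Measure.pi_map_pi (μ := fun _ : Fin d => gaussianReal 0 1)
    (f := fun _ x => -x) (fun i => by fun_prop)
  simp only [gaussianReal_map_neg, neg_zero] at h2
  exact h2

lemma anderson_shift {d : ℕ} (B : Matrix (Fin d) (Fin d) ℝ)
    (C : Set (Fin d → ℝ)) (hCmeas : MeasurableSet C)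
    (hCconv : Convex ℝ C) (hCsymm : ∀ x ∈ C, -x ∈ C) (v : Fin d → ℝ) :
    _root_.stdGaussian d {z | B.mulVec z + v ∈ C} ≤ _root_.stdGaussian d {z | B.mulVec z ∈ C} := by
  have hBm : Measurable B.mulVec := (Continuous.matrix_mulVec continuous_const continuous_id).measurable
  have m1 : MeasurableSet {z | B.mulVec z + v ∈ C} := (hBm.add_const v) hCmeas
  have m2 : MeasurableSet {z | B.mulVec z - v ∈ C} := (hBm.sub_const v) hCmeas
  have m0 : MeasurableSet {z | B.mulVec z ∈ C} := hBm hCmeas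
  have e : _root_.stdGaussian d {z | B.mulVec z - v ∈ C} =
      _root_.stdGaussian d {z | B.mulVec z + v ∈ C} := by
    conv_lhs => rw [← std_neg d]
    rw [Measure.map_apply (by fun_prop) m2]
    congr 1
    ext z
    simp only [Set.mem_preimage, Set.mem_ofPred_eq, Matrix.mulVec_neg]
    constructor
    · intro h
      convert! hCsymm _ h using 1
      abel
    · intro h
      convert! hCsymm _ h using 1
      abel
  have := std_logconcave d m1 m2 m0 (fun x hx y hy => by
    have hm := hCconv hx hy (show (0:ℝ) ≤ 1/2 by norm_num) (show (0:ℝ) ≤ 1/2 by norm_num)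
      (by norm_num)
    have h' : (fun i => (x i + y i) / 2) = (1/2 : ℝ) • x + (1/2 : ℝ) • y := by
      ext i; simp; ring
    simp only [Set.mem_ofPred_eq]
    rw [h', Matrix.mulVec_add, Matrix.mulVec_smul, Matrix.mulVec_smul]
    convert! hm using 1
    ext i; simp; ring)
  rw [e, ← sq] at this
  exact (ENNReal.pow_le_pow_left_iff two_ne_zero).1 this

lemma charFunDual_std {d : ℕ} (A : Matrix (Fin d) (Fin d) ℝ) (L : StrongDual ℝ (Fin d → ℝ)) :
    charFunDual ((_root_.stdGaussian d).map A.mulVec) L =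
      Complex.exp (-(((fun i => L (Pi.single i 1)) ⬝ᵥ ((A * Aᵀ) *ᵥ fun i => L (Pi.single i 1)) : ℝ) : ℂ) / 2) := by
  have hAm : Measurable A.mulVec := (Continuous.matrix_mulVec continuous_const continuous_id).measurable
  set l : Fin d → ℝ := fun i => L (Pi.single i 1) with hl
  have hL : ∀ x, L x = l ⬝ᵥ x := by
    intro x
    conv_lhs => rw [pi_eq_sum_univ' x]
    simp [dotProduct, hl, mul_comm]
  rw [charFunDual_apply, integral_map hAm.aemeasurable (by fun_prop)]
  have h1 : ∀ x : Fin d → ℝ, Complex.exp (L (A *ᵥ x) * Complex.I) =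
      ∏ i, Complex.exp (((l ᵥ* A) i : ℝ) * (x i : ℝ) * Complex.I) := by
    intro x
    rw [hL, Matrix.dotProduct_mulVec, ← Complex.exp_sum, ← Finset.sum_mul]
    simp [dotProduct]
  simp_rw [h1]
  unfold _root_.stdGaussian
  rw [integral_fintype_prod_eq_prod (f := fun i (x : ℝ) =>
    Complex.exp (((l ᵥ* A) i : ℝ) * (x : ℝ) * Complex.I))]
  simp_rw [← charFun_apply_real, charFun_gaussianReal, ← Complex.exp_sum]
  congr 1
  rw [← Matrix.mulVec_mulVec, Matrix.dotProduct_mulVec, Matrix.mulVec_transpose]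
  simp [dotProduct, neg_div, Finset.sum_div, sq]

/-- Anderson's comparison inequality: if `X ∼ N(0, Σ_X)` and `Y ∼ N(0, Σ_Y)`
(realized as linear images `A·Z`, `B·Z` of a standard Gaussian, with
`A Aᵀ = Σ_X`, `B Bᵀ = Σ_Y`) and `Σ_X − Σ_Y` is positive semi-definite, then
`P(X ∈ C) ≤ P(Y ∈ C)` for every convex symmetric measurable set `C`. -/
theorem anderson_comparison {d : ℕ}
    (A B SX SY : Matrix (Fin d) (Fin d) ℝ)
    (hA : A * Aᵀ = SX) (hB : B * Bᵀ = SY)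
    (hpsd : (SX - SY).PosSemidef)
    (C : Set (Fin d → ℝ)) (hCmeas : MeasurableSet C)
    (hCconv : Convex ℝ C) (hCsymm : ∀ x ∈ C, -x ∈ C) :
    (stdGaussian d).map A.mulVec C ≤ (stdGaussian d).map B.mulVec C := by
  have hm : ∀ A : Matrix (Fin d) (Fin d) ℝ, Measurable A.mulVec := fun A =>
    (Continuous.matrix_mulVec continuous_const continuous_id).measurable
  have hp : ∀ A : Matrix (Fin d) (Fin d) ℝ,
      IsProbabilityMeasure ((_root_.stdGaussian d).map A.mulVec) := fun A =>
    Measure.isProbabilityMeasure_map (hm A).aemeasurable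
  open scoped MatrixOrder Matrix.Norms.L2Operator in
  obtain ⟨D, hD⟩ : ∃ D : Matrix (Fin d) (Fin d) ℝ, SX - SY = D * Dᵀ := by
    obtain ⟨E, hE⟩ := CStarAlgebra.nonneg_iff_eq_star_mul_self.mp hpsd.nonneg
    exact ⟨Eᵀ, by rw [hE]; simp [Matrix.star_eq_conjTranspose, Matrix.conjTranspose_eq_transpose_of_trivial]⟩
  have hconv : (_root_.stdGaussian d).map A.mulVec =
      ((_root_.stdGaussian d).map D.mulVec) ∗ ((_root_.stdGaussian d).map B.mulVec) := by
    apply Measure.ext_of_charFunDual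
    ext L
    rw [charFunDual_conv, charFunDual_std, charFunDual_std, charFunDual_std, ← Complex.exp_add,
      hA, hB, ← hD, Matrix.sub_mulVec, dotProduct_sub]
    congr 1
    push_cast
    ring
  change (_root_.stdGaussian d).map A.mulVec C ≤ (_root_.stdGaussian d).map B.mulVec C
  rw [hconv, ← lintegral_indicator_one hCmeas,
    Measure.lintegral_conv (measurable_one.indicator hCmeas)]
  calc _ ≤ ∫⁻ x, (_root_.stdGaussian d).map B.mulVec C ∂((_root_.stdGaussian d).map D.mulVec) := by
        refine lintegral_mono fun v => ?_
        have hset : MeasurableSet {y | v + y ∈ C} := (measurable_const_add v) hCmeas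
        have : (fun y => C.indicator (1 : (Fin d → ℝ) → ENNReal) (v + y)) =
            {y | v + y ∈ C}.indicator 1 := by
          ext y; simp [Set.indicator]
        simp only [this]
        rw [lintegral_indicator_one hset, Measure.map_apply (hm B) hset,
          Measure.map_apply (hm B) hCmeas]
        refine le_trans (le_of_eq ?_) (anderson_shift B C hCmeas hCconv hCsymm v)
        congr 1
        ext z
        simp [add_comm]
    _ = _ := by simp
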